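/- (Strong Addition) Let u, v be λ-quasi-convex on a neighborhood of x₀ ∈ ℝⁿ and suppose w = u + v has an upper contact jet (p₀, A₀) at x₀. Then for every set E of full measure near x₀ there is a sequence x_j ∈ E, x_j → x₀, with u and v both twice differentiable at each x_j, such that D²u(x_j) → A and D²v(x_j) → B for symmetric matrices A, B with A + B ≤ A₀, and Du(x_j) → Du(x₀), Dv(x_j) → Dv(x₀) with Du(x₀) + Dv(x₀) = p₀. -/

import Mathlib

open scoped RealInnerProductSpace Topology
open Filter MeasureTheory

/-- The quadratic form `⟨A v, v⟩` associated to a matrix `A`. -/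
noncomputable def quad {n : ℕ} (A : Matrix (Fin n) (Fin n) ℝ)
    (v : EuclideanSpace ℝ (Fin n)) : ℝ :=
  ∑ i, ∑ j, A i j * v i * v j

/-- `(p, A)` is an upper contact jet for `w` at `x₀`. -/
def UpperContactJet {n : ℕ} (w : EuclideanSpace ℝ (Fin n) → ℝ)
    (x₀ p : EuclideanSpace ℝ (Fin n)) (A : Matrix (Fin n) (Fin n) ℝ) : Prop :=
  ∀ᶠ y in 𝓝 x₀, w y ≤ w x₀ + ⟪p, y - x₀⟫ + (1 / 2) * quad A (y - x₀)

/-- `w` is twice differentiable at `x` with gradient `g` and Hessian `H`, in the sense of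
a second-order Taylor expansion. -/
def TwiceDiffAt {n : ℕ} (w : EuclideanSpace ℝ (Fin n) → ℝ)
    (x g : EuclideanSpace ℝ (Fin n)) (H : Matrix (Fin n) (Fin n) ℝ) : Prop :=
  HasGradientAt w g x ∧
    (fun y => w y - w x - ⟪g, y - x⟫ - (1 / 2) * quad H (y - x)) =o[𝓝 x]
      fun y => ‖y - x‖ ^ 2

/-- `w` is `lam`-quasi-convex on `U`: `w + (lam/2)|·|²` is convex on `U`. -/
def QCOn {n : ℕ} (lam : ℝ) (U : Set (EuclideanSpace ℝ (Fin n)))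
    (w : EuclideanSpace ℝ (Fin n) → ℝ) : Prop :=
  ConvexOn ℝ U (fun x => w x + (lam / 2) * ‖x‖ ^ 2)

section Subgradients

variable {V : Type*} [NormedAddCommGroup V] [InnerProductSpace ℝ V]

/-- `q` is a subgradient at `x` of `f` restricted to `U`. -/
def IsSubgrad (U : Set V) (f : V → ℝ) (x q : V) : Prop :=
  ∀ z ∈ U, f x + ⟪q, z - x⟫ ≤ f z

/-- A local second-order lower bound on a convex function gives a subgradient. -/
lemma isSubgrad_of_eventually_lower {U : Set V} {f : V → ℝ} (hf : ConvexOn ℝ U f) {x q : V}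
    (hx : x ∈ U) {C : ℝ}
    (h : ∀ᶠ z in 𝓝 x, f x + ⟪q, z - x⟫ - C * ‖z - x‖ ^ 2 ≤ f z) : IsSubgrad U f x q := by
  intro z hz
  have hT : Tendsto (fun t : ℝ => x + t • (z - x)) (𝓝[>] 0) (𝓝 x) := by
    have : ContinuousAt (fun t : ℝ => x + t • (z - x)) 0 := by fun_prop
    simpa [ContinuousAt] using this.tendsto.mono_left nhdsWithin_le_nhds
  have hlim : Tendsto (fun t : ℝ => f x + ⟪q, z - x⟫ - C * t * ‖z - x‖ ^ 2) (𝓝[>] 0)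
      (𝓝 (f x + ⟪q, z - x⟫)) := by
    have : ContinuousAt (fun t : ℝ => f x + ⟪q, z - x⟫ - C * t * ‖z - x‖ ^ 2) 0 := by fun_prop
    simpa [ContinuousAt] using this.tendsto.mono_left nhdsWithin_le_nhds
  refine le_of_tendsto hlim ?_
  filter_upwards [hT.eventually h, Ioo_mem_nhdsGT (zero_lt_one' ℝ)] with t ht ht01
  obtain ⟨h0, h1⟩ := ht01
  have hc := hf.2 hx hz (by linarith : 0 ≤ 1 - t) h0.le (by ring)
  have e : (1 - t) • x + t • z = x + t • (z - x) := by
    rw [smul_sub, sub_smul, one_smul]; abel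
  rw [e] at hc
  rw [add_sub_cancel_left, inner_smul_right, norm_smul, mul_pow, Real.norm_eq_abs, sq_abs] at ht
  simp only [smul_eq_mul] at hc
  have : t * (f x + ⟪q, z - x⟫ - C * t * ‖z - x‖ ^ 2) ≤ t * f z := by nlinarith
  exact le_of_mul_le_mul_left this h0

/-- A local second-order upper bound on a convex function gives a subgradient. -/
lemma isSubgrad_of_eventually_upper {U : Set V} (hU : IsOpen U) {f : V → ℝ}
    (hf : ConvexOn ℝ U f) {x q : V} (hx : x ∈ U) {C : ℝ}
    (h : ∀ᶠ z in 𝓝 x, f z ≤ f x + ⟪q, z - x⟫ + C * ‖z - x‖ ^ 2) : IsSubgrad U f x q := by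
  refine isSubgrad_of_eventually_lower hf hx (C := C) ?_
  have hT : Tendsto (fun z : V => (2 : ℝ) • x - z) (𝓝 x) (𝓝 x) := by
    have : ContinuousAt (fun z : V => (2 : ℝ) • x - z) x := by fun_prop
    have e : (2 : ℝ) • x - x = x := by rw [two_smul]; abel
    simpa only [ContinuousAt, e] using this
  filter_upwards [hT.eventually h, hT.eventually (hU.mem_nhds hx), hU.mem_nhds hx]
    with z hz hzU hzU'
  have hc := hf.2 hzU' hzU (by norm_num : (0 : ℝ) ≤ 1 / 2) (by norm_num : (0 : ℝ) ≤ 1 / 2)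
    (by norm_num)
  have e : (1 / 2 : ℝ) • z + (1 / 2 : ℝ) • ((2 : ℝ) • x - z) = x := by module
  have e2 : (2 : ℝ) • x - z - x = -(z - x) := by module
  rw [e] at hc
  rw [e2, inner_neg_right, norm_neg] at hz
  simp only [smul_eq_mul] at hc
  linarith

/-- Subgradients depend Lipschitz-continuously on the point, near a point where the function
has a second-order upper bound. -/
lemma norm_sub_le_of_isSubgrad {U : Set V} {f : V → ℝ} {x y p q : V} {C ρ : ℝ}
    (hU : Metric.ball x ρ ⊆ U)
    (hup : ∀ z ∈ Metric.ball x ρ, f z ≤ f x + ⟪q, z - x⟫ + C * ‖z - x‖ ^ 2) (hC : 0 ≤ C)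
    (hq : f x + ⟪q, y - x⟫ ≤ f y) (hp : IsSubgrad U f y p) (hxy : 2 * ‖y - x‖ < ρ) :
    ‖p - q‖ ≤ 4 * C * ‖y - x‖ := by
  have key : ∀ s : ℝ, ‖y - x‖ < s → s < ρ / 2 → ‖p - q‖ ≤ 4 * C * s := by
    intro s hs hsρ
    have hs0 : 0 < s := (norm_nonneg _).trans_lt hs
    rcases eq_or_ne p q with rfl | hne
    · simp; positivity
    have hn : 0 < ‖p - q‖ := norm_pos_iff.2 (sub_ne_zero.2 hne)
    set e : V := (‖p - q‖)⁻¹ • (p - q) with he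
    have hen : ‖e‖ = 1 := by
      rw [he, norm_smul, norm_inv, norm_norm, inv_mul_cancel₀ hn.ne']
    have hin : ⟪p - q, e⟫ = ‖p - q‖ := by
      rw [he, inner_smul_right, real_inner_self_eq_norm_sq]; field_simp
    have hzx : ‖y + s • e - x‖ ≤ 2 * s := by
      have : y + s • e - x = (y - x) + s • e := by abel
      rw [this]
      refine (norm_add_le _ _).trans ?_
      rw [norm_smul, hen, Real.norm_of_nonneg hs0.le]; linarith
    have hzb : y + s • e ∈ Metric.ball x ρ := by
      rw [mem_ball_iff_norm]; linarith
    have h1 := hup _ hzb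
    have h2 := hp _ (hU hzb)
    have h3 : ‖y + s • e - x‖ ^ 2 ≤ (2 * s) ^ 2 := by gcongr
    have h4 : y + s • e - x = (y - x) + s • e := by abel
    rw [add_sub_cancel_left, inner_smul_right] at h2
    have h5 : ⟪q, y + s • e - x⟫ = ⟪q, y - x⟫ + s * ⟪q, e⟫ := by
      rw [h4, inner_add_right, inner_smul_right]
    rw [inner_sub_left] at hin
    have h6 : C * ‖y + s • e - x‖ ^ 2 ≤ C * (2 * s) ^ 2 := by gcongr
    have h7 : s * ‖p - q‖ ≤ s * (4 * C * s) := by rw [← hin]; nlinarith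
    exact le_of_mul_le_mul_left h7 hs0
  have hlim : Tendsto (fun s : ℝ => 4 * C * s) (𝓝[>] ‖y - x‖) (𝓝 (4 * C * ‖y - x‖)) := by
    have : ContinuousAt (fun s : ℝ => 4 * C * s) ‖y - x‖ := by fun_prop
    exact this.tendsto.mono_left nhdsWithin_le_nhds
  refine ge_of_tendsto hlim ?_
  filter_upwards [Ioo_mem_nhdsGT (by linarith : ‖y - x‖ < ρ / 2)] with s hs
  exact key s hs.1 hs.2

/-- A convex function on an open set of a finite-dimensional space has a subgradient at every
point. -/
lemma exists_isSubgrad [FiniteDimensional ℝ V] {U : Set V} (hU : IsOpen U) {f : V → ℝ}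
    (hf : ConvexOn ℝ U f) {x : V} (hx : x ∈ U) : ∃ q, IsSubgrad U f x q := by
  have hopen : IsOpen {p : V × ℝ | p.1 ∈ U ∧ f p.1 < p.2} := by
    rw [isOpen_iff_mem_nhds]
    rintro ⟨a, t⟩ ⟨ha, hat⟩
    have hc : ContinuousAt f a := (hf.continuousOn hU).continuousAt (hU.mem_nhds ha)
    have h1 : ∀ᶠ p : V × ℝ in 𝓝 (a, t), p.1 ∈ U :=
      continuous_fst.continuousAt.eventually (hU.mem_nhds ha)
    have h2 : ContinuousAt (fun p : V × ℝ => f p.1) (a, t) :=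
      ContinuousAt.comp (x := (a, t)) (f := Prod.fst) hc continuous_fst.continuousAt
    filter_upwards [h1, h2.eventually_lt continuous_snd.continuousAt hat] with p hp hp'
    exact ⟨hp, hp'⟩
  obtain ⟨F, hF⟩ := geometric_hahn_banach_open_point hf.convex_strict_epigraph hopen
    (x := (x, f x)) (by simp)
  set c : ℝ := F (0, 1) with hc
  have hdec : ∀ (a : V) (t : ℝ), F (a, t) = F (a, 0) + t * c := by
    intro a t
    have : ((a, t) : V × ℝ) = (a, 0) + t • (0, 1) := by simp
    rw [this, map_add, map_smul, smul_eq_mul]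
  have hc0 : c < 0 := by
    have := hF (x, f x + 1) ⟨hx, by simp⟩
    rw [hdec x (f x + 1), hdec x (f x)] at this
    linarith
  set G : StrongDual ℝ V := F.comp (ContinuousLinearMap.inl ℝ V ℝ) with hG
  refine ⟨(InnerProductSpace.toDual ℝ V).symm ((-c)⁻¹ • G), fun z hz => ?_⟩
  rw [InnerProductSpace.toDual_symm_apply]
  have hGz : ∀ a, G a = F (a, 0) := fun a => by simp [hG]
  have key : ∀ t, f z < t → F (z, 0) + t * c ≤ F (x, 0) + f x * c := by
    intro t ht
    have := hF (z, t) ⟨hz, ht⟩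
    rw [hdec z t, hdec x (f x)] at this
    exact this.le
  have key2 : F (z, 0) + f z * c ≤ F (x, 0) + f x * c := by
    have hlim : Tendsto (fun t : ℝ => F (z, 0) + t * c) (𝓝[>] f z) (𝓝 (F (z, 0) + f z * c)) := by
      have : ContinuousAt (fun t : ℝ => F (z, 0) + t * c) (f z) := by fun_prop
      exact this.tendsto.mono_left nhdsWithin_le_nhds
    refine le_of_tendsto hlim ?_
    filter_upwards [self_mem_nhdsWithin] with t ht using key t ht
  have : ((-c)⁻¹ • G) (z - x) = (-c)⁻¹ * (F (z, 0) - F (x, 0)) := by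
    rw [smul_apply, map_sub, hGz, hGz, smul_eq_mul]
  rw [this]
  have h3 : (-c)⁻¹ * (F (z, 0) - F (x, 0)) ≤ f z - f x := by
    rw [inv_mul_le_iff₀ (by linarith)]
    linarith
  linarith

/-- Two-sided second-order bounds on increments give a gradient. -/
lemma hasGradientAt_of_abs_le_sq [CompleteSpace V] {f : V → ℝ} {x q : V} {C : ℝ}
    (h : ∀ᶠ z in 𝓝 x, |f z - f x - ⟪q, z - x⟫| ≤ C * ‖z - x‖ ^ 2) : HasGradientAt f q x := by
  rw [hasGradientAt_iff_hasFDerivAt, hasFDerivAt_iff_isLittleO]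
  have h1 : (fun z => f z - f x - (InnerProductSpace.toDual ℝ V q) (z - x)) =O[𝓝 x]
      fun z => ‖z - x‖ ^ 2 := by
    refine Asymptotics.IsBigO.of_bound C ?_
    filter_upwards [h] with z hz
    simpa using hz
  refine h1.trans_isLittleO ?_
  have h2 : (fun z : V => ‖z - x‖ ^ 2) =o[𝓝 x] fun z => ‖z - x‖ := by
    have h3 : Tendsto (fun z : V => ‖z - x‖) (𝓝 x) (𝓝 0) := by
      have : ContinuousAt (fun z : V => ‖z - x‖) x := by fun_prop
      simpa [ContinuousAt] using this
    exact (Asymptotics.isLittleO_pow_id (one_lt_two)).comp_tendsto h3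
  exact h2.of_norm_right

end Subgradients

section Resolvent

variable {V : Type*} [NormedAddCommGroup V] [InnerProductSpace ℝ V]

lemma IsSubgrad.inner_nonneg {U : Set V} {f : V → ℝ} {x x' q q' : V} (hx : x ∈ U) (hx' : x' ∈ U)
    (h : IsSubgrad U f x q) (h' : IsSubgrad U f x' q') : 0 ≤ ⟪q - q', x - x'⟫ := by
  have h1 := h x' hx'
  have h2 := h' x hx
  rw [inner_sub_left]
  rw [← neg_sub x x', inner_neg_right] at h1
  linarith

/-- `x` is the image of `y` under the resolvent `(I + ∂f)⁻¹`. -/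
def IsResolvent (U : Set V) (f : V → ℝ) (y x : V) : Prop :=
  x ∈ U ∧ IsSubgrad U f x (y - x)

lemma IsResolvent.norm_sq_le {U : Set V} {f : V → ℝ} {x x' y y' : V}
    (h : IsResolvent U f y x) (h' : IsResolvent U f y' x') :
    ‖x - x'‖ ^ 2 ≤ ⟪y - y', x - x'⟫ := by
  have := IsSubgrad.inner_nonneg h.1 h'.1 h.2 h'.2
  have e : y - x - (y' - x') = (y - y') - (x - x') := by abel
  rw [e, inner_sub_left, real_inner_self_eq_norm_sq] at this
  linarith

lemma IsResolvent.norm_le {U : Set V} {f : V → ℝ} {x x' y y' : V}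
    (h : IsResolvent U f y x) (h' : IsResolvent U f y' x') : ‖x - x'‖ ≤ ‖y - y'‖ := by
  have h1 := h.norm_sq_le h'
  have h2 := real_inner_le_norm (y - y') (x - x')
  rcases (norm_nonneg (x - x')).eq_or_lt with h0 | h0
  · rw [← h0]; positivity
  · nlinarith

lemma IsResolvent.unique {U : Set V} {f : V → ℝ} {x x' y : V}
    (h : IsResolvent U f y x) (h' : IsResolvent U f y x') : x = x' := by
  have := h.norm_le h'
  rw [sub_self, norm_zero] at this
  exact sub_eq_zero.1 (norm_le_zero_iff.1 this)

/-- The range of `I + ∂f` is open. -/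
lemma isOpen_setOf_exists_isResolvent [FiniteDimensional ℝ V] {U : Set V} (hU : IsOpen U)
    {f : V → ℝ} (hf : ConvexOn ℝ U f) : IsOpen {y | ∃ x, IsResolvent U f y x} := by
  rw [Metric.isOpen_iff]
  rintro y ⟨x, hx, hsub⟩
  obtain ⟨ε, hε, hball⟩ := Metric.nhds_basis_closedBall.mem_iff.1 (hU.mem_nhds hx)
  refine ⟨ε / 2, by positivity, fun y' hy' => ?_⟩
  rw [mem_ball_iff_norm] at hy'
  have hcont : ContinuousOn (fun z => f z + ‖z - y'‖ ^ 2 / 2) (Metric.closedBall x ε) :=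
    ((hf.continuousOn hU).mono hball).add (by fun_prop)
  obtain ⟨x', hx', hmin⟩ := (isCompact_closedBall x ε).exists_isMinOn
    ⟨x, Metric.mem_closedBall_self hε.le⟩ hcont
  have expand : ∀ a b : V, ‖b - y'‖ ^ 2 = ‖a - y'‖ ^ 2 + 2 * ⟪a - y', b - a⟫ + ‖b - a‖ ^ 2 := by
    intro a b
    rw [← norm_add_sq_real]; congr 2; abel
  have h1 : f x' + ‖x' - y'‖ ^ 2 / 2 ≤ f x + ‖x - y'‖ ^ 2 / 2 :=
    hmin (Metric.mem_closedBall_self hε.le)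
  have h2 := hsub x' (hball hx')
  have h3 : ‖x' - x‖ ≤ 2 * ‖y' - y‖ := by
    rw [expand x x'] at h1
    have e : ⟪y - x, x' - x⟫ + ⟪x - y', x' - x⟫ = -⟪y' - y, x' - x⟫ := by
      rw [← inner_add_left, ← inner_neg_left]; congr 1; abel
    have h4 := real_inner_le_norm (y' - y) (x' - x)
    rcases (norm_nonneg (x' - x)).eq_or_lt with h0 | h0
    · rw [← h0]; positivity
    · nlinarith
  have hx'b : x' ∈ Metric.ball x ε := by
    rw [mem_ball_iff_norm]; linarith
  refine ⟨x', hball hx', isSubgrad_of_eventually_lower hf (hball hx') (C := 1 / 2) ?_⟩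
  filter_upwards [Metric.isOpen_ball.mem_nhds hx'b] with z hz
  have h5 : f x' + ‖x' - y'‖ ^ 2 / 2 ≤ f z + ‖z - y'‖ ^ 2 / 2 :=
    hmin (Metric.ball_subset_closedBall hz)
  rw [expand x' z] at h5
  have e : ⟪y' - x', z - x'⟫ = -⟪x' - y', z - x'⟫ := by
    rw [← inner_neg_left, neg_sub]
  rw [e]; linarith

/-- Bounds on the subgradients of a function on `[0, 1]` integrate to bounds on its increment. -/
lemma sub_mem_Icc_of_subgrad_bounds {φ d : ℝ → ℝ} {α a b : ℝ}
    (hφ : ∀ s ∈ Set.Icc (0 : ℝ) 1, ∀ t ∈ Set.Icc (0 : ℝ) 1, φ s + (t - s) * d s ≤ φ t)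
    (ha : ∀ s ∈ Set.Icc (0 : ℝ) 1, d s ≤ α + s * a)
    (hb : ∀ s ∈ Set.Icc (0 : ℝ) 1, α + s * b ≤ d s) :
    φ 1 - φ 0 ∈ Set.Icc (α + b / 2) (α + a / 2) := by
  have main : ∀ N : ℕ, ∀ k : ℕ, k ≤ N + 1 →
      φ (k / (N + 1)) - φ 0 ≤ k / (N + 1) * α + k * (k + 1) / (2 * (N + 1) ^ 2) * a ∧
      k / (N + 1) * α + k * (k - 1) / (2 * (N + 1) ^ 2) * b ≤ φ (k / (N + 1)) - φ 0 := by
    intro N k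
    have hN : (0 : ℝ) < N + 1 := by positivity
    induction k with
    | zero => intro _; simp
    | succ k ih =>
      intro hk
      obtain ⟨h1, h2⟩ := ih (by omega)
      have hk' : (k : ℝ) + 1 ≤ N + 1 := by exact_mod_cast hk
      have m1 : (k / (N + 1) : ℝ) ∈ Set.Icc (0 : ℝ) 1 :=
        ⟨by positivity, by rw [div_le_one hN]; linarith⟩
      have m2 : ((k + 1) / (N + 1) : ℝ) ∈ Set.Icc (0 : ℝ) 1 :=
        ⟨by positivity, by rw [div_le_one hN]; linarith⟩
      have i1 := hφ _ m1 _ m2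
      have i2 := hφ _ m2 _ m1
      have j1 := hb _ m1
      have j2 := ha _ m2
      have hinv : (0 : ℝ) ≤ 1 / (N + 1) := by positivity
      have e : ((k + 1) / (N + 1) : ℝ) - k / (N + 1) = 1 / (N + 1) := by field_simp; ring
      have e' : (k / (N + 1) : ℝ) - (k + 1) / (N + 1) = -(1 / (N + 1)) := by field_simp; ring
      rw [e] at i1
      rw [e'] at i2
      have k1 := mul_le_mul_of_nonneg_left j1 hinv
      have k2 := mul_le_mul_of_nonneg_left j2 hinv
      push_cast
      constructor
      · have : ((k + 1) / (N + 1) * α + (k + 1) * (k + 1 + 1) / (2 * (N + 1) ^ 2) * a : ℝ) =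
            (k / (N + 1) * α + k * (k + 1) / (2 * (N + 1) ^ 2) * a) +
            1 / (N + 1) * (α + (k + 1) / (N + 1) * a) := by field_simp; ring
        rw [this]; linarith
      · have : ((k + 1) / (N + 1) * α + (k + 1) * (k + 1 - 1) / (2 * (N + 1) ^ 2) * b : ℝ) =
            (k / (N + 1) * α + k * (k - 1) / (2 * (N + 1) ^ 2) * b) +
            1 / (N + 1) * (α + k / (N + 1) * b) := by field_simp; ring
        rw [this]; linarith
  have hlim : Tendsto (fun N : ℕ => (1 : ℝ) / (N + 1)) atTop (𝓝 0) :=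
    tendsto_one_div_add_atTop_nhds_zero_nat
  have bd : ∀ N : ℕ, φ 1 - φ 0 ≤ α + (1 + 1 / (N + 1)) / 2 * a ∧
      α + (1 - 1 / (N + 1)) / 2 * b ≤ φ 1 - φ 0 := by
    intro N
    have hN : (N : ℝ) + 1 ≠ 0 := by positivity
    have h := main N (N + 1) le_rfl
    push_cast at h
    rw [div_self hN] at h
    have e1 : ((N + 1) * (N + 1 + 1) / (2 * (N + 1) ^ 2) : ℝ) = (1 + 1 / (N + 1)) / 2 := by
      field_simp
    have e2 : ((N + 1) * (N + 1 - 1) / (2 * (N + 1) ^ 2) : ℝ) = (1 - 1 / (N + 1)) / 2 := by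
      field_simp
    rw [e1, e2] at h
    simpa using h
  constructor
  · have : Tendsto (fun N : ℕ => α + (1 - 1 / ((N : ℝ) + 1)) / 2 * b) atTop
        (𝓝 (α + (1 - 0) / 2 * b)) :=
      (((tendsto_const_nhds.sub hlim).div_const 2).mul_const b).const_add α
    rw [sub_zero, one_div_mul_eq_div] at this
    exact le_of_tendsto' this fun N => (bd N).2
  · have : Tendsto (fun N : ℕ => α + (1 + 1 / ((N : ℝ) + 1)) / 2 * a) atTop
        (𝓝 (α + (1 + 0) / 2 * a)) :=
      (((tendsto_const_nhds.add hlim).div_const 2).mul_const a).const_add α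
    rw [add_zero, one_div_mul_eq_div] at this
    exact ge_of_tendsto' this fun N => (bd N).1

/-- If subgradients near `x` have a first-order expansion, then `f` has a second-order one. -/
lemma isLittleO_of_subgrad_expansion [FiniteDimensional ℝ V] {U : Set V} (hU : IsOpen U)
    {f : V → ℝ} (hf : ConvexOn ℝ U f) {x q : V} (hx : x ∈ U) (T : V →L[ℝ] V)
    (h : ∀ ε > 0, ∃ δ > 0, ∀ z p, ‖z - x‖ < δ → z ∈ U → IsSubgrad U f z p →
      ‖p - q - T (z - x)‖ ≤ ε * ‖z - x‖) :
    (fun z => f z - f x - ⟪q, z - x⟫ - (1 / 2) * ⟪T (z - x), z - x⟫) =o[𝓝 x]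
      fun z => ‖z - x‖ ^ 2 := by
  rw [Asymptotics.isLittleO_iff]
  intro ε hε
  obtain ⟨δ, hδ, hT⟩ := h ε hε
  obtain ⟨η, hη, hball⟩ := Metric.isOpen_iff.1 hU x hx
  filter_upwards [Metric.ball_mem_nhds x (lt_min hδ hη)] with z hz
  rw [mem_ball_iff_norm] at hz
  have hzδ := hz.trans_le (min_le_left _ _)
  have hzη := hz.trans_le (min_le_right _ _)
  set w := z - x with hw
  have hnorm : ∀ s ∈ Set.Icc (0 : ℝ) 1, ‖x + s • w - x‖ = s * ‖w‖ := by
    intro s hs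
    rw [add_sub_cancel_left, norm_smul, Real.norm_of_nonneg hs.1]
  have hle : ∀ s ∈ Set.Icc (0 : ℝ) 1, ‖x + s • w - x‖ ≤ ‖w‖ := by
    intro s hs
    rw [hnorm s hs]
    exact mul_le_of_le_one_left (norm_nonneg _) hs.2
  have hmem : ∀ s ∈ Set.Icc (0 : ℝ) 1, x + s • w ∈ U := fun s hs =>
    hball (by rw [mem_ball_iff_norm]; exact (hle s hs).trans_lt hzη)
  have hex : ∀ s : ℝ, ∃ p, s ∈ Set.Icc (0 : ℝ) 1 → IsSubgrad U f (x + s • w) p := by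
    intro s
    by_cases hs : s ∈ Set.Icc (0 : ℝ) 1
    · obtain ⟨p, hp⟩ := exists_isSubgrad hU hf (hmem s hs)
      exact ⟨p, fun _ => hp⟩
    · exact ⟨0, fun h => absurd h hs⟩
  choose p hp using hex
  have hbd : ∀ s ∈ Set.Icc (0 : ℝ) 1,
      |⟪p s, w⟫ - ⟪q, w⟫ - s * ⟪T w, w⟫| ≤ s * (ε * ‖w‖ ^ 2) := by
    intro s hs
    have h1 := hT _ _ ((hle s hs).trans_lt hzδ) (hmem s hs) (hp s hs)
    have h2 := abs_real_inner_le_norm (p s - q - T (x + s • w - x)) w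
    have e : ⟪p s - q - T (x + s • w - x), w⟫ = ⟪p s, w⟫ - ⟪q, w⟫ - s * ⟪T w, w⟫ := by
      rw [add_sub_cancel_left, map_smul, inner_sub_left, inner_sub_left, real_inner_smul_left]
    rw [e] at h2
    rw [hnorm s hs] at h1
    calc _ ≤ _ := h2
      _ ≤ (ε * (s * ‖w‖)) * ‖w‖ := by gcongr
      _ = _ := by ring
  have key := sub_mem_Icc_of_subgrad_bounds (φ := fun s => f (x + s • w))
    (d := fun s => ⟪p s, w⟫) (α := ⟪q, w⟫) (a := ⟪T w, w⟫ + ε * ‖w‖ ^ 2)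
    (b := ⟪T w, w⟫ - ε * ‖w‖ ^ 2)
    (fun s hs t ht => by
      have := hp s hs _ (hmem t ht)
      have e : x + t • w - (x + s • w) = (t - s) • w := by module
      rwa [e, inner_smul_right] at this)
    (fun s hs => by have := (abs_le.1 (hbd s hs)).2; linarith)
    (fun s hs => by have := (abs_le.1 (hbd s hs)).1; linarith)
  have e1 : x + (1 : ℝ) • w = z := by rw [one_smul, hw]; abel
  simp only [e1, zero_smul, add_zero] at key
  have hn : 0 ≤ ε * ‖w‖ ^ 2 := by positivity
  rw [Real.norm_eq_abs, Real.norm_of_nonneg (by positivity), abs_le]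
  constructor <;> linarith [key.1, key.2]

end Resolvent

section Alexandrov

variable {V : Type*} [NormedAddCommGroup V] [InnerProductSpace ℝ V]

/-- The derivative of the resolvent is firmly nonexpansive. -/
lemma norm_sq_le_of_hasFDerivAt_resolvent {U : Set V} {f : V → ℝ} {J : V → V} {y : V}
    (hJ : ∀ᶠ y' in 𝓝 y, IsResolvent U f y' (J y')) {M : V →L[ℝ] V} (hM : HasFDerivAt J M y)
    (e : V) : ‖M e‖ ^ 2 ≤ ⟪e, M e⟫ := by
  have hy : IsResolvent U f y (J y) := hJ.self_of_nhds
  have hline : HasDerivAt (fun t : ℝ => J (y + t • e)) (M e) 0 := by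
    have h1 : HasDerivAt (fun t : ℝ => y + t • e) e 0 := by
      simpa using ((hasDerivAt_id (0 : ℝ)).smul_const e).const_add y
    have hM' : HasFDerivAt J M (y + (0 : ℝ) • e) := by simpa using hM
    exact hM'.comp_hasDerivAt (0 : ℝ) h1
  have hslope := (hasDerivAt_iff_tendsto_slope.1 hline).mono_left
    (nhdsWithin_mono (0 : ℝ) (fun t (ht : 0 < t) => ht.ne') : 𝓝[>] (0 : ℝ) ≤ 𝓝[≠] 0)
  have hT : Tendsto (fun t : ℝ => y + t • e) (𝓝[>] 0) (𝓝 y) := by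
    have : ContinuousAt (fun t : ℝ => y + t • e) 0 := by fun_prop
    simpa [ContinuousAt] using this.tendsto.mono_left nhdsWithin_le_nhds
  refine le_of_tendsto_of_tendsto (hslope.norm.pow 2) (tendsto_const_nhds.inner hslope) ?_
  filter_upwards [hT.eventually hJ, self_mem_nhdsWithin] with t ht ht0
  have ht0' : (0 : ℝ) < t := ht0
  have h2 := ht.norm_sq_le hy
  rw [add_sub_cancel_left, real_inner_smul_left] at h2
  simp only [slope, sub_zero, zero_smul, add_zero, vsub_eq_sub]
  rw [norm_smul, inner_smul_right, mul_pow, norm_inv, Real.norm_of_nonneg ht0'.le]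
  calc t⁻¹ ^ 2 * ‖J (y + t • e) - J y‖ ^ 2 ≤ t⁻¹ ^ 2 * (t * ⟪e, J (y + t • e) - J y⟫) := by gcongr
    _ = _ := by field_simp

/-- Where the resolvent has an invertible derivative `M`, the subdifferential has the first-order
expansion with linear part `M⁻¹ - I`. -/
lemma subgrad_expansion_of_hasFDerivAt_resolvent {U : Set V} {f : V → ℝ} {J : V → V} {y : V}
    (hJ : ∀ᶠ y' in 𝓝 y, IsResolvent U f y' (J y')) (M : V ≃L[ℝ] V)
    (hM : HasFDerivAt J (M : V →L[ℝ] V) y) {ε : ℝ} (hε : 0 < ε) :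
    ∃ δ > 0, ∀ z p, ‖z - J y‖ < δ → z ∈ U → IsSubgrad U f z p →
      ‖p - (y - J y) - ((M.symm : V →L[ℝ] V) - ContinuousLinearMap.id ℝ V) (z - J y)‖
        ≤ ε * ‖z - J y‖ := by
  have hy : IsResolvent U f y (J y) := hJ.self_of_nhds
  set x := J y with hx
  set N : V →L[ℝ] V := (M.symm : V →L[ℝ] V) with hN
  set K : ℝ := ‖N‖ + 1 with hK
  have hK0 : 0 < K := by positivity
  have hNK : ∀ v, ‖N v‖ ≤ K * ‖v‖ := fun v =>
    (N.le_opNorm v).trans (by gcongr; linarith)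
  set κ : ℝ := (K⁻¹) ^ 2 with hκ
  have hκ0 : 0 < κ := by positivity
  have hpos : ∀ e, κ * ‖e‖ ^ 2 ≤ ⟪e, M e⟫ := by
    intro e
    have h1 := norm_sq_le_of_hasFDerivAt_resolvent hJ hM e
    have h2 : ‖e‖ ≤ K * ‖M e‖ := by simpa [hN] using hNK (M e)
    have h3 : K⁻¹ * ‖e‖ ≤ ‖M e‖ := by rwa [inv_mul_le_iff₀ hK0]
    calc κ * ‖e‖ ^ 2 = (K⁻¹ * ‖e‖) ^ 2 := by rw [hκ]; ring
      _ ≤ ‖M e‖ ^ 2 := by gcongr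
      _ ≤ _ := h1
  have happrox : ∀ c > 0, ∃ η > 0, ∀ y', ‖y' - y‖ ≤ η →
      IsResolvent U f y' (J y') ∧ ‖J y' - x - M (y' - y)‖ ≤ c * ‖y' - y‖ := by
    intro c hc
    have := (hasFDerivAt_iff_isLittleO.1 hM).bound hc
    obtain ⟨η, hη, h⟩ := Metric.nhds_basis_closedBall.eventually_iff.1 (hJ.and this)
    exact ⟨η, hη, fun y' hy' => h (mem_closedBall_iff_norm.2 hy')⟩
  obtain ⟨η, hη, hη'⟩ := happrox (κ / 2) (by positivity)
  have hcoer : ∀ y', ‖y' - y‖ ≤ η → κ / 2 * ‖y' - y‖ ^ 2 ≤ ⟪y' - y, J y' - x⟫ := by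
    intro y' hy'
    have h1 := (hη' y' hy').2
    have h2 := hpos (y' - y)
    have h3 := neg_le_of_abs_le (abs_real_inner_le_norm (y' - y) (J y' - x - M (y' - y)))
    rw [inner_sub_right] at h3
    have h4 : ‖y' - y‖ * ‖J y' - x - M (y' - y)‖ ≤ ‖y' - y‖ * (κ / 2 * ‖y' - y‖) := by gcongr
    nlinarith
  have hlip : ∀ z y', ‖z - x‖ < κ / 2 * η → IsResolvent U f y' z →
      ‖y' - y‖ ≤ η ∧ κ / 2 * ‖y' - y‖ ≤ ‖z - x‖ := by
    intro z y' hz hy'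
    have hcs := real_inner_le_norm (y' - y) (z - x)
    by_cases hle : ‖y' - y‖ ≤ η
    · refine ⟨hle, ?_⟩
      have h1 := hcoer y' hle
      rw [(hη' y' hle).1.unique hy'] at h1
      rcases (norm_nonneg (y' - y)).eq_or_lt with h0 | h0
      · rw [← h0]; simp
      · nlinarith
    · exfalso
      push Not at hle
      have hn : 0 < ‖y' - y‖ := hη.trans hle
      set t := η / ‖y' - y‖ with ht
      have ht0 : 0 < t := by positivity
      have ht1 : t < 1 := by rw [ht, div_lt_one hn]; exact hle
      have htn : t * ‖y' - y‖ = η := by rw [ht]; field_simp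
      set yt := y + t • (y' - y) with hyt
      have e1 : yt - y = t • (y' - y) := by rw [hyt]; abel
      have e2 : y' - yt = (1 - t) • (y' - y) := by rw [hyt]; module
      have hnt : ‖yt - y‖ = η := by rw [e1, norm_smul, Real.norm_of_nonneg ht0.le, htn]
      have h1 := hcoer yt hnt.le
      have h2 := (sq_nonneg _).trans (hy'.norm_sq_le (hη' yt hnt.le).1)
      rw [e2, real_inner_smul_left] at h2
      have h3 : 0 ≤ ⟪y' - y, z - J yt⟫ := nonneg_of_mul_nonneg_right h2 (by linarith)
      have e3 : z - J yt = (z - x) - (J yt - x) := by abel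
      rw [e3, inner_sub_right] at h3
      rw [hnt, e1, real_inner_smul_left] at h1
      have h4 : κ / 2 * η * ‖y' - y‖ ≤ ⟪y' - y, J yt - x⟫ := by
        have : t * (κ / 2 * η * ‖y' - y‖) ≤ t * ⟪y' - y, J yt - x⟫ := by
          calc t * (κ / 2 * η * ‖y' - y‖) = κ / 2 * η * (t * ‖y' - y‖) := by ring
            _ = κ / 2 * η ^ 2 := by rw [htn]; ring
            _ ≤ _ := h1
        exact le_of_mul_le_mul_left this ht0
      nlinarith
  set c : ℝ := ε * (κ / 2) / K with hc
  have hc0 : 0 < c := by positivity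
  obtain ⟨η₂, hη₂, happ⟩ := happrox c hc0
  refine ⟨min (κ / 2 * η) (κ / 2 * η₂), by positivity, fun z p hz hzU hp => ?_⟩
  have hres : IsResolvent U f (z + p) z := ⟨hzU, by simpa using hp⟩
  obtain ⟨-, h2⟩ := hlip z (z + p) (hz.trans_le (min_le_left _ _)) hres
  have h3 : ‖z + p - y‖ ≤ η₂ := by
    have := h2.trans (hz.trans_le (min_le_right _ _)).le
    exact le_of_mul_le_mul_left this (by positivity)
  obtain ⟨h4, h5⟩ := happ _ h3
  rw [h4.unique hres] at h5
  have e : p - (y - x) - (N - ContinuousLinearMap.id ℝ V) (z - x)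
      = -N (z - x - M (z + p - y)) := by
    have : N (M (z + p - y)) = z + p - y := by simp [hN]
    rw [map_sub N, this, sub_apply, ContinuousLinearMap.id_apply]
    abel
  rw [e, norm_neg]
  calc _ ≤ K * ‖z - x - M (z + p - y)‖ := hNK _
    _ ≤ K * (c * ‖z + p - y‖) := by gcongr
    _ = ε * (κ / 2 * ‖z + p - y‖) := by rw [hc]; field_simp
    _ ≤ _ := by gcongr

variable [FiniteDimensional ℝ V] [MeasurableSpace V] [BorelSpace V]

/-- Lipschitz maps of a finite-dimensional space send null sets to null sets. -/
lemma volume_image_eq_zero_of_lipschitzOnWith {K : NNReal} {J : V → V} {s : Set V}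
    (hJ : LipschitzOnWith K J s) (hs : volume s = 0) : volume (J '' s) = 0 := by
  have h1 : (μH[(Module.finrank ℝ V : ℝ)] : Measure V) ≪ volume :=
    Measure.absolutelyContinuous_isAddHaarMeasure _ _
  have h2 : (volume : Measure V) ≪ μH[(Module.finrank ℝ V : ℝ)] :=
    Measure.absolutelyContinuous_isAddHaarMeasure _ _
  apply h2
  refine le_antisymm ((hJ.hausdorffMeasure_image_le (Nat.cast_nonneg _)).trans ?_) zero_le
  rw [h1 hs, mul_zero]

/-- **Alexandrov's theorem**: a convex function on an open set has a second-order Taylor expansion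
at almost every point. -/
theorem ConvexOn.ae_exists_taylor_two {U : Set V} (hU : IsOpen U) {f : V → ℝ}
    (hf : ConvexOn ℝ U f) : ∀ᵐ x, x ∈ U → ∃ (q : V) (T : V →L[ℝ] V),
      (fun z => f z - f x - ⟪q, z - x⟫ - (1 / 2) * ⟪T (z - x), z - x⟫) =o[𝓝 x]
        fun z => ‖z - x‖ ^ 2 := by
  set Y := {y | ∃ x, IsResolvent U f y x} with hYdef
  have hY : IsOpen Y := isOpen_setOf_exists_isResolvent hU hf
  have hex : ∀ y : V, ∃ x, y ∈ Y → IsResolvent U f y x := by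
    intro y
    by_cases hy : y ∈ Y
    · obtain ⟨x, hx⟩ := hy
      exact ⟨x, fun _ => hx⟩
    · exact ⟨0, fun h => absurd h hy⟩
  choose J hJ using hex
  have hLip : LipschitzOnWith 1 J Y := by
    refine LipschitzOnWith.of_dist_le_mul fun a ha b hb => ?_
    simpa [dist_eq_norm] using (hJ a ha).norm_le (hJ b hb)
  set N₁ := {y ∈ Y | ¬ DifferentiableAt ℝ J y} with hN₁
  set N₂ := {y ∈ Y | DifferentiableAt ℝ J y ∧ (fderiv ℝ J y).det = 0} with hN₂
  have h₁ : volume (J '' N₁) = 0 := by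
    refine volume_image_eq_zero_of_lipschitzOnWith (hLip.mono fun y hy => hy.1) ?_
    have := hLip.ae_differentiableWithinAt_of_mem (μ := volume)
    refine measure_mono_null (fun y hy => ?_) (ae_iff.1 this)
    simp only [Set.mem_ofPred_eq, Classical.not_imp]
    exact ⟨hy.1, fun h => hy.2 (h.differentiableAt (hY.mem_nhds hy.1))⟩
  have h₂ : volume (J '' N₂) = 0 :=
    addHaar_image_eq_zero_of_det_fderivWithin_eq_zero volume
      (fun y hy => hy.2.1.hasFDerivAt.hasFDerivWithinAt) (fun y hy => hy.2.2)
  have hae₁ : ∀ᵐ x, x ∉ J '' N₁ := measure_eq_zero_iff_ae_notMem.1 h₁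
  have hae₂ : ∀ᵐ x, x ∉ J '' N₂ := measure_eq_zero_iff_ae_notMem.1 h₂
  filter_upwards [hae₁, hae₂] with x hx₁ hx₂ hxU
  obtain ⟨q, hq⟩ := exists_isSubgrad hU hf hxU
  have hres : IsResolvent U f (x + q) x := ⟨hxU, by simpa using hq⟩
  have hyY : x + q ∈ Y := ⟨x, hres⟩
  have hJx : J (x + q) = x := (hJ _ hyY).unique hres
  have hdiff : DifferentiableAt ℝ J (x + q) := by
    by_contra h
    exact hx₁ ⟨x + q, ⟨hyY, h⟩, hJx⟩
  have hdet : (fderiv ℝ J (x + q)).det ≠ 0 := fun h => hx₂ ⟨x + q, ⟨hyY, hdiff, h⟩, hJx⟩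
  set M := (fderiv ℝ J (x + q)).toContinuousLinearEquivOfDetNeZero hdet with hMdef
  have hM : HasFDerivAt J (M : V →L[ℝ] V) (x + q) := by
    rw [hMdef, ContinuousLinearMap.coe_toContinuousLinearEquivOfDetNeZero]
    exact hdiff.hasFDerivAt
  have hev : ∀ᶠ y in 𝓝 (x + q), IsResolvent U f y (J y) := by
    filter_upwards [hY.mem_nhds hyY] with y hy using hJ y hy
  refine ⟨q, (M.symm : V →L[ℝ] V) - ContinuousLinearMap.id ℝ V,
    isLittleO_of_subgrad_expansion hU hf hxU _ fun ε hε => ?_⟩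
  have := subgrad_expansion_of_hasFDerivAt_resolvent hev M hM hε
  rwa [hJx, add_sub_cancel_left] at this

end Alexandrov

section ContactPoints

variable {V : Type*} [NormedAddCommGroup V] [InnerProductSpace ℝ V]

lemma inner_apply_self_le (T : V →L[ℝ] V) (v : V) : ⟪T v, v⟫ ≤ ‖T‖ * ‖v‖ ^ 2 :=
  calc ⟪T v, v⟫ ≤ ‖T v‖ * ‖v‖ := real_inner_le_norm _ _
    _ ≤ (‖T‖ * ‖v‖) * ‖v‖ := by gcongr; exact T.le_opNorm v
    _ = _ := by ring

/-- **Jensen's lemma**: if `G` is convex and `G - Q`, with `Q` quadratic, has a strict maximum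
at `x₀`, then the points near `x₀` at which `G` is touched from above by a translate of `Q` up to
an affine function do not form a null set. -/
lemma volume_contact_ne_zero [FiniteDimensional ℝ V] [MeasurableSpace V] [BorelSpace V]
    {U : Set V} (hU : IsOpen U) {G : V → ℝ} (hG : ConvexOn ℝ U G) {x₀ b : V} {T : V →L[ℝ] V}
    (hT : ∀ x y, ⟪T x, y⟫ = ⟪x, T y⟫) {ρ ε : ℝ} (hρ : 0 < ρ) (hε : 0 < ε)
    (hball : Metric.closedBall x₀ ρ ⊆ U)
    (hmax : ∀ z ∈ Metric.closedBall x₀ ρ,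
      G z ≤ G x₀ + ⟪b, z - x₀⟫ + (1 / 2) * ⟪T (z - x₀), z - x₀⟫ - ε * ‖z - x₀‖ ^ 2) :
    volume {x ∈ Metric.ball x₀ ρ | ∃ q, ∀ᶠ z in 𝓝 x,
      G z ≤ G x + ⟪q, z - x⟫ + (1 / 2) * ⟪T (z - x), z - x⟫} ≠ 0 := by
  set Q : V → ℝ := fun z => ⟪b, z - x₀⟫ + (1 / 2) * ⟪T (z - x₀), z - x₀⟫ with hQ
  set contact : V → V → Prop := fun x p => ‖x - x₀‖ ≤ ρ / 10 ∧
    ∀ z ∈ Metric.closedBall x₀ ρ,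
      G z - Q z - ⟪p, z - x₀⟫ ≤ G x - Q x - ⟪p, x - x₀⟫ with hcontact
  have hexp : ∀ x z, Q z = Q x + ⟪b + T (x - x₀), z - x⟫ + (1 / 2) * ⟪T (z - x), z - x⟫ := by
    intro x z
    have e : z - x₀ = (x - x₀) + (z - x) := by abel
    have hs : ⟪T (z - x), x - x₀⟫ = ⟪T (x - x₀), z - x⟫ := by
      rw [hT, real_inner_comm]
    simp only [hQ]
    rw [e]
    simp only [map_add, inner_add_left, inner_add_right, hs]
    ring
  have hupper : ∀ x p, contact x p → ∀ z ∈ Metric.closedBall x₀ ρ,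
      G z ≤ G x + ⟪p + (b + T (x - x₀)), z - x⟫ + (1 / 2) * ⟪T (z - x), z - x⟫ := by
    intro x p hx z hz
    have h1 := hx.2 z hz
    have h2 := hexp x z
    have e : z - x₀ = (x - x₀) + (z - x) := by abel
    have h3 : ⟪p, z - x₀⟫ = ⟪p, x - x₀⟫ + ⟪p, z - x⟫ := by rw [e, inner_add_right]
    rw [inner_add_left]
    linarith
  have hsubset : ∀ x, ‖x - x₀‖ ≤ ρ / 10 →
      Metric.ball x (9 / 10 * ρ) ⊆ Metric.closedBall x₀ ρ := by
    intro x hx z hz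
    rw [mem_ball_iff_norm] at hz
    rw [mem_closedBall_iff_norm]
    have : z - x₀ = (z - x) + (x - x₀) := by abel
    rw [this]
    exact (norm_add_le _ _).trans (by linarith)
  have hupperC : ∀ x p, contact x p → ∀ z ∈ Metric.ball x (9 / 10 * ρ),
      G z ≤ G x + ⟪p + (b + T (x - x₀)), z - x⟫ + ‖T‖ / 2 * ‖z - x‖ ^ 2 := by
    intro x p hx z hz
    have h1 := hupper x p hx z (hsubset x hx.1 hz)
    have h2 := inner_apply_self_le T (z - x)
    linarith
  have hmemU : ∀ x p, contact x p → x ∈ U := fun x p hx =>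
    hball (hsubset x hx.1 (Metric.mem_ball_self (by positivity)))
  have hsubg : ∀ x p, contact x p → IsSubgrad U G x (p + (b + T (x - x₀))) := by
    intro x p hx
    refine isSubgrad_of_eventually_upper hU hG (hmemU x p hx) (C := ‖T‖ / 2) ?_
    filter_upwards [Metric.ball_mem_nhds x (by positivity : 0 < 9 / 10 * ρ)] with z hz
    exact hupperC x p hx z hz
  have hlip : ∀ x p x' p', contact x p → contact x' p' → ‖p' - p‖ ≤ 3 * ‖T‖ * ‖x' - x‖ := by
    intro x p x' p' hx hx'
    have hd : ‖x' - x‖ ≤ ρ / 5 := by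
      have : x' - x = (x' - x₀) - (x - x₀) := by abel
      rw [this]
      exact (norm_sub_le _ _).trans (by linarith [hx.1, hx'.1])
    have h1 := norm_sub_le_of_isSubgrad ((hsubset x hx.1).trans hball) (hupperC x p hx)
      (by positivity) (hsubg x p hx x' (hmemU x' p' hx')) (hsubg x' p' hx') (by linarith)
    have e : p' - p = (p' + (b + T (x' - x₀)) - (p + (b + T (x - x₀)))) - T (x' - x) := by
      have : x' - x = (x' - x₀) - (x - x₀) := by abel
      rw [this, map_sub T (x' - x₀)]
      abel
    rw [e]
    refine (norm_sub_le _ _).trans ?_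
    have h2 := T.le_opNorm (x' - x)
    linarith
  have hexists : ∀ p ∈ Metric.closedBall (0 : V) (ε * ρ / 10), ∃ x, contact x p := by
    intro p hp
    rw [mem_closedBall_zero_iff] at hp
    have hcont : ContinuousOn (fun z => G z - Q z - ⟪p, z - x₀⟫) (Metric.closedBall x₀ ρ) := by
      refine (((hG.continuousOn hU).mono hball).sub ?_).sub ?_
      · simp only [hQ]; fun_prop
      · fun_prop
    obtain ⟨x, hx, hmx⟩ := (isCompact_closedBall x₀ ρ).exists_isMaxOn
      ⟨x₀, Metric.mem_closedBall_self hρ.le⟩ hcont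
    refine ⟨x, ?_, fun z hz => hmx hz⟩
    have h1 : G x₀ - Q x₀ - ⟪p, x₀ - x₀⟫ ≤ G x - Q x - ⟪p, x - x₀⟫ :=
      hmx (Metric.mem_closedBall_self hρ.le)
    have h2 := hmax x hx
    have h3 : Q x₀ = 0 := by simp [hQ]
    have h4 : Q x = ⟪b, x - x₀⟫ + (1 / 2) * ⟪T (x - x₀), x - x₀⟫ := rfl
    rw [h3, sub_self, inner_zero_right] at h1
    have h5 := neg_le_of_abs_le (abs_real_inner_le_norm p (x - x₀))
    have h6 : ‖p‖ * ‖x - x₀‖ ≤ ε * ρ / 10 * ‖x - x₀‖ := by gcongr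
    rcases (norm_nonneg (x - x₀)).eq_or_lt with h0 | h0
    · rw [← h0]; positivity
    · have : (ε * ‖x - x₀‖) * ‖x - x₀‖ ≤ (ε * (ρ / 10)) * ‖x - x₀‖ := by nlinarith
      exact le_of_mul_le_mul_left (le_of_mul_le_mul_right this h0) hε
  intro hnull
  set K : Set V := {x | ∃ p, contact x p} with hK
  have hKnull : volume K = 0 := by
    refine measure_mono_null ?_ hnull
    rintro x ⟨p, hx⟩
    refine ⟨?_, p + (b + T (x - x₀)), ?_⟩
    · rw [mem_ball_iff_norm]; linarith [hx.1]
    · filter_upwards [Metric.ball_mem_nhds x (by positivity : 0 < 9 / 10 * ρ)] with z hz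
      exact hupper x p hx z (hsubset x hx.1 hz)
  have hchoice : ∀ x, ∃ p, x ∈ K → contact x p := by
    intro x
    by_cases hx : x ∈ K
    · obtain ⟨p, hp⟩ := hx
      exact ⟨p, fun _ => hp⟩
    · exact ⟨0, fun h => absurd h hx⟩
  choose P hP using hchoice
  have hPlip : LipschitzOnWith (3 * ‖T‖₊) P K := by
    refine LipschitzOnWith.of_dist_le_mul fun a ha c hc => ?_
    simpa [dist_eq_norm] using hlip _ _ _ _ (hP c hc) (hP a ha)
  have himage : Metric.closedBall (0 : V) (ε * ρ / 10) ⊆ P '' K := by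
    intro p hp
    obtain ⟨x, hx⟩ := hexists p hp
    refine ⟨x, ⟨p, hx⟩, ?_⟩
    have := hlip _ _ _ _ hx (hP x ⟨p, hx⟩)
    rw [sub_self, norm_zero, mul_zero] at this
    exact sub_eq_zero.1 (norm_le_zero_iff.1 this)
  have h0 := measure_mono_null himage (volume_image_eq_zero_of_lipschitzOnWith hPlip hKnull)
  exact (Metric.measure_closedBall_pos volume (0 : V) (by positivity)).ne' h0

/-- The second symmetric difference quotient of a function with a second-order Taylor
expansion. -/
lemma tendsto_second_difference {f : V → ℝ} {x q : V} {T : V →L[ℝ] V}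
    (h : (fun z => f z - f x - ⟪q, z - x⟫ - (1 / 2) * ⟪T (z - x), z - x⟫) =o[𝓝 x]
      fun z => ‖z - x‖ ^ 2) (e : V) :
    Tendsto (fun t : ℝ => (f (x + t • e) + f (x - t • e) - 2 * f x) / t ^ 2) (𝓝[>] 0)
      (𝓝 ⟪T e, e⟫) := by
  have aux : ∀ a : V, Tendsto (fun t : ℝ => (f (x + t • a) - f x - t * ⟪q, a⟫) / t ^ 2) (𝓝[>] 0)
      (𝓝 ((1 / 2) * ⟪T a, a⟫)) := by
    intro a
    have hT : Tendsto (fun t : ℝ => x + t • a) (𝓝[>] 0) (𝓝 x) := by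
      have : ContinuousAt (fun t : ℝ => x + t • a) 0 := by fun_prop
      simpa [ContinuousAt] using this.tendsto.mono_left nhdsWithin_le_nhds
    have h1 := h.comp_tendsto hT
    have h2 : (fun t : ℝ => f (x + t • a) - f x - t * ⟪q, a⟫ - t ^ 2 * ((1 / 2) * ⟪T a, a⟫))
        =o[𝓝[>] 0] fun t => t ^ 2 := by
      refine (h1.congr_left fun t => ?_).trans_isBigO ?_
      · simp only [Function.comp, add_sub_cancel_left, map_smul, inner_smul_right,
          real_inner_smul_left]
        ring
      · refine Asymptotics.IsBigO.of_bound (‖a‖ ^ 2) (Eventually.of_forall fun t => ?_)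
        simp [norm_smul, mul_pow, mul_comm]
    have h3 := (h2.tendsto_div_nhds_zero).add_const ((1 / 2) * ⟪T a, a⟫)
    rw [zero_add] at h3
    refine h3.congr' ?_
    filter_upwards [self_mem_nhdsWithin] with t ht
    have ht' : t ≠ 0 := (show (0 : ℝ) < t from ht).ne'
    field_simp
    ring
  have h1 := (aux e).add (aux (-e))
  have e1 : (1 / 2) * ⟪T e, e⟫ + (1 / 2) * ⟪T (-e), -e⟫ = ⟪T e, e⟫ := by
    rw [map_neg, inner_neg_neg]; ring
  rw [e1] at h1
  refine h1.congr fun t => ?_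
  rw [← add_div, inner_neg_right, smul_neg, ← sub_eq_add_neg]
  congr 1
  ring

/-- A convex function has nonnegative second-order Taylor coefficient. -/
lemma ConvexOn.inner_taylor_nonneg {U : Set V} (hU : IsOpen U) {f : V → ℝ} (hf : ConvexOn ℝ U f)
    {x q : V} (hx : x ∈ U) {T : V →L[ℝ] V}
    (h : (fun z => f z - f x - ⟪q, z - x⟫ - (1 / 2) * ⟪T (z - x), z - x⟫) =o[𝓝 x]
      fun z => ‖z - x‖ ^ 2) (e : V) : 0 ≤ ⟪T e, e⟫ := by
  refine ge_of_tendsto (tendsto_second_difference h e) ?_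
  have c1 : ContinuousAt (fun t : ℝ => x + t • e) 0 := by fun_prop
  have c2 : ContinuousAt (fun t : ℝ => x - t • e) 0 := by fun_prop
  have m1 := c1.preimage_mem_nhds (t := U) (by simpa using hU.mem_nhds hx)
  have m2 := c2.preimage_mem_nhds (t := U) (by simpa using hU.mem_nhds hx)
  filter_upwards [nhdsWithin_le_nhds m1, nhdsWithin_le_nhds m2] with t h1 h2
  have hc := hf.2 h1 h2 (by norm_num : (0 : ℝ) ≤ 1 / 2) (by norm_num : (0 : ℝ) ≤ 1 / 2)
    (by norm_num)
  have e : (1 / 2 : ℝ) • (x + t • e) + (1 / 2 : ℝ) • (x - t • e) = x := by module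
  rw [e] at hc
  simp only [smul_eq_mul] at hc
  apply div_nonneg _ (sq_nonneg t)
  linarith

/-- If `f + g` is touched from above at `x`, the second-order Taylor coefficients of `f` and `g`
add up to at most that of the touching function. -/
lemma inner_taylor_add_le {f g : V → ℝ} {x q qf qg : V} {T Tf Tg : V →L[ℝ] V}
    (hf : (fun z => f z - f x - ⟪qf, z - x⟫ - (1 / 2) * ⟪Tf (z - x), z - x⟫) =o[𝓝 x]
      fun z => ‖z - x‖ ^ 2)
    (hg : (fun z => g z - g x - ⟪qg, z - x⟫ - (1 / 2) * ⟪Tg (z - x), z - x⟫) =o[𝓝 x]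
      fun z => ‖z - x‖ ^ 2)
    (h : ∀ᶠ z in 𝓝 x, f z + g z ≤ f x + g x + ⟪q, z - x⟫ + (1 / 2) * ⟪T (z - x), z - x⟫)
    (e : V) : ⟪Tf e, e⟫ + ⟪Tg e, e⟫ ≤ ⟪T e, e⟫ := by
  refine le_of_tendsto ((tendsto_second_difference hf e).add (tendsto_second_difference hg e)) ?_
  have c1 : ContinuousAt (fun t : ℝ => x + t • e) 0 := by fun_prop
  have c2 : ContinuousAt (fun t : ℝ => x - t • e) 0 := by fun_prop
  have m1 := c1.tendsto.eventually (p := fun z => f z + g z ≤ f x + g x + ⟪q, z - x⟫ +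
    (1 / 2) * ⟪T (z - x), z - x⟫) (by simpa using h)
  have m2 := c2.tendsto.eventually (p := fun z => f z + g z ≤ f x + g x + ⟪q, z - x⟫ +
    (1 / 2) * ⟪T (z - x), z - x⟫) (by simpa using h)
  filter_upwards [nhdsWithin_le_nhds m1, nhdsWithin_le_nhds m2, self_mem_nhdsWithin]
    with t h1 h2 ht
  have ht0 : (0 : ℝ) < t := ht
  have e2 : x - t • e - x = -(t • e) := by abel
  rw [add_sub_cancel_left] at h1
  rw [e2, map_neg, inner_neg_neg, inner_neg_right] at h2
  rw [map_smul, inner_smul_right, inner_smul_right, real_inner_smul_left] at h1 h2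
  rw [← add_div, div_le_iff₀ (by positivity)]
  linarith

/-- If `f` and `g` are convex and `f + g` is strictly touched from above at `x₀` by a quadratic
function, then any set of full measure near `x₀` contains points close to `x₀` at which `f` and `g`
have second-order Taylor expansions compatible with the touching function. -/
lemma exists_taylor_two_add_le [FiniteDimensional ℝ V] [MeasurableSpace V] [BorelSpace V]
    {U : Set V} (hU : IsOpen U) {f g : V → ℝ} (hf : ConvexOn ℝ U f) (hg : ConvexOn ℝ U g)
    {x₀ b : V} {T : V →L[ℝ] V}
    (hT : ∀ x y, ⟪T x, y⟫ = ⟪x, T y⟫) {ρ ε : ℝ} (hρ : 0 < ρ) (hε : 0 < ε)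
    (hball : Metric.closedBall x₀ ρ ⊆ U)
    (hmax : ∀ z ∈ Metric.closedBall x₀ ρ, f z + g z ≤ f x₀ + g x₀ + ⟪b, z - x₀⟫ +
      (1 / 2) * ⟪T (z - x₀), z - x₀⟫ - ε * ‖z - x₀‖ ^ 2)
    {S : Set V} (hS : ∀ᵐ x, x ∈ Metric.ball x₀ ρ → x ∈ S) :
    ∃ (x qf qg : V) (Tf Tg : V →L[ℝ] V), x ∈ Metric.ball x₀ ρ ∧ x ∈ S ∧
      (fun z => f z - f x - ⟪qf, z - x⟫ - (1 / 2) * ⟪Tf (z - x), z - x⟫) =o[𝓝 x]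
        (fun z => ‖z - x‖ ^ 2) ∧
      (fun z => g z - g x - ⟪qg, z - x⟫ - (1 / 2) * ⟪Tg (z - x), z - x⟫) =o[𝓝 x]
        (fun z => ‖z - x‖ ^ 2) ∧
      (∀ e, 0 ≤ ⟪Tf e, e⟫) ∧ (∀ e, 0 ≤ ⟪Tg e, e⟫) ∧
      ∀ e, ⟪Tf e, e⟫ + ⟪Tg e, e⟫ ≤ ⟪T e, e⟫ := by
  have hne := volume_contact_ne_zero hU (hf.add hg) hT hρ hε hball hmax
  obtain ⟨x, ⟨hxb, q, hq⟩, hxf, hxg, hxS⟩ :=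
    ((frequently_ae_mem_iff.2 hne).and_eventually
      ((hf.ae_exists_taylor_two hU).and ((hg.ae_exists_taylor_two hU).and hS))).exists
  have hxU : x ∈ U := hball (Metric.ball_subset_closedBall hxb)
  obtain ⟨qf, Tf, hTf⟩ := hxf hxU
  obtain ⟨qg, Tg, hTg⟩ := hxg hxU
  exact ⟨x, qf, qg, Tf, Tg, hxb, hxS hxb, hTf, hTg, hf.inner_taylor_nonneg hU hxU hTf,
    hg.inner_taylor_nonneg hU hxU hTg, inner_taylor_add_le hTf hTg hq⟩

end ContactPoints

section Matrices

variable {n : ℕ}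

/-- The symmetric matrix with the same quadratic form as the operator `T`. -/
noncomputable def symmMatrix (T : EuclideanSpace ℝ (Fin n) →L[ℝ] EuclideanSpace ℝ (Fin n)) :
    Matrix (Fin n) (Fin n) ℝ :=
  fun i j => (⟪T (EuclideanSpace.single i 1), EuclideanSpace.single j 1⟫ +
    ⟪T (EuclideanSpace.single j 1), EuclideanSpace.single i 1⟫) / 2

lemma isSymm_symmMatrix (T : EuclideanSpace ℝ (Fin n) →L[ℝ] EuclideanSpace ℝ (Fin n)) :
    (symmMatrix T).IsSymm :=
  Matrix.IsSymm.ext fun i j => by simp only [symmMatrix]; ring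

lemma quad_symmMatrix (T : EuclideanSpace ℝ (Fin n) →L[ℝ] EuclideanSpace ℝ (Fin n))
    (v : EuclideanSpace ℝ (Fin n)) : quad (symmMatrix T) v = ⟪T v, v⟫ := by
  have hv : v = ∑ i, v i • EuclideanSpace.single i (1 : ℝ) := by
    simpa using ((EuclideanSpace.basisFun (Fin n) ℝ).sum_repr v).symm
  have h1 : ⟪T v, v⟫ = ∑ i, ∑ j, v i * v j *
      ⟪T (EuclideanSpace.single i 1), EuclideanSpace.single j 1⟫ := by
    conv_lhs => rw [hv]
    simp only [map_sum, map_smul, sum_inner, inner_sum, real_inner_smul_left, inner_smul_right,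
      Finset.mul_sum]
    rw [Finset.sum_comm]
    refine Finset.sum_congr rfl fun i _ => Finset.sum_congr rfl fun j _ => ?_
    ring
  have h2 : ⟪T v, v⟫ = ∑ i, ∑ j, v i * v j *
      ⟪T (EuclideanSpace.single j 1), EuclideanSpace.single i 1⟫ := by
    refine (h1.trans Finset.sum_comm).trans ?_
    refine Finset.sum_congr rfl fun i _ => Finset.sum_congr rfl fun j _ => ?_
    ring
  have h3 : quad (symmMatrix T) v + quad (symmMatrix T) v = ⟪T v, v⟫ + ⟪T v, v⟫ := by
    conv_rhs => arg 1; rw [h1]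
    conv_rhs => arg 2; rw [h2]
    simp only [quad, symmMatrix, ← Finset.sum_add_distrib]
    refine Finset.sum_congr rfl fun i _ => Finset.sum_congr rfl fun j _ => ?_
    ring
  linarith

lemma quad_eq_dotProduct (A : Matrix (Fin n) (Fin n) ℝ) (v : EuclideanSpace ℝ (Fin n)) :
    quad A v = dotProduct v (A.mulVec v) := by
  simp only [quad, dotProduct, Matrix.mulVec, Finset.mul_sum]
  refine Finset.sum_congr rfl fun i _ => Finset.sum_congr rfl fun j _ => ?_
  ring

lemma exists_selfAdjoint_inner_eq_quad {A : Matrix (Fin n) (Fin n) ℝ} (hA : A.IsSymm) :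
    ∃ T : EuclideanSpace ℝ (Fin n) →L[ℝ] EuclideanSpace ℝ (Fin n),
      (∀ x y, ⟪T x, y⟫ = ⟪x, T y⟫) ∧ ∀ v, ⟪T v, v⟫ = quad A v := by
  have hH : A.IsHermitian := by
    rw [Matrix.IsHermitian, Matrix.conjTranspose_eq_transpose_of_trivial, hA]
  refine ⟨LinearMap.toContinuousLinearMap (Matrix.toEuclideanLin A), fun x y => ?_, fun v => ?_⟩
  · exact Matrix.isSymmetric_toEuclideanLin_iff.2 hH x y
  · rw [quad_eq_dotProduct, real_inner_comm]
    simp [PiLp.inner_apply, dotProduct, mul_comm]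

lemma abs_apply_le_of_abs_quad_le {H : Matrix (Fin n) (Fin n) ℝ} (hH : H.IsSymm) {C : ℝ}
    (hC : 0 ≤ C) (h : ∀ v, |quad H v| ≤ C * ‖v‖ ^ 2) (i j : Fin n) : |H i j| ≤ 2 * C := by
  have hsingle : ∀ i j : Fin n, dotProduct (EuclideanSpace.single i (1 : ℝ)).ofLp
      (H.mulVec (EuclideanSpace.single j (1 : ℝ)).ofLp) = H i j := by
    intro i j; simp
  have e1 : quad H (EuclideanSpace.single i 1 + EuclideanSpace.single j 1) =
      H i i + H j j + 2 * H i j := by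
    rw [quad_eq_dotProduct, WithLp.ofLp_add, Matrix.mulVec_add, add_dotProduct, dotProduct_add,
      dotProduct_add, hsingle, hsingle, hsingle, hsingle, hH.apply j i]
    ring
  have e2 : quad H (EuclideanSpace.single i 1 - EuclideanSpace.single j 1) =
      H i i + H j j - 2 * H i j := by
    rw [quad_eq_dotProduct, WithLp.ofLp_sub, Matrix.mulVec_sub, sub_dotProduct, dotProduct_sub,
      dotProduct_sub, hsingle, hsingle, hsingle, hsingle, hH.apply j i]
    ring
  have n1 : ‖EuclideanSpace.single i (1 : ℝ) + EuclideanSpace.single j 1‖ ≤ 2 := by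
    refine (norm_add_le _ _).trans ?_
    simp; norm_num
  have n2 : ‖EuclideanSpace.single i (1 : ℝ) - EuclideanSpace.single j 1‖ ≤ 2 := by
    refine (norm_sub_le _ _).trans ?_
    simp; norm_num
  have b1 : C * ‖EuclideanSpace.single i (1 : ℝ) + EuclideanSpace.single j 1‖ ^ 2 ≤ C * 2 ^ 2 := by
    gcongr
  have b2 : C * ‖EuclideanSpace.single i (1 : ℝ) - EuclideanSpace.single j 1‖ ^ 2 ≤ C * 2 ^ 2 := by
    gcongr
  have h1 := abs_le.1 ((h _).trans b1)
  have h2 := abs_le.1 ((h _).trans b2)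
  rw [e1] at h1
  rw [e2] at h2
  rw [abs_le]
  constructor <;> linarith [h1.1, h1.2, h2.1, h2.2]

lemma continuous_quad (v : EuclideanSpace ℝ (Fin n)) :
    Continuous fun A : Matrix (Fin n) (Fin n) ℝ => quad A v := by
  unfold quad
  fun_prop

lemma exists_subseq_tendsto_of_abs_apply_le {H H' : ℕ → Matrix (Fin n) (Fin n) ℝ} {C : ℝ}
    (h : ∀ k i j, |H k i j| ≤ C) (h' : ∀ k i j, |H' k i j| ≤ C) :
    ∃ (A B : Matrix (Fin n) (Fin n) ℝ) (φ : ℕ → ℕ), StrictMono φ ∧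
      Tendsto (H ∘ φ) atTop (𝓝 A) ∧ Tendsto (H' ∘ φ) atTop (𝓝 B) := by
  have hc : IsCompact {A : Matrix (Fin n) (Fin n) ℝ | ∀ i j, A i j ∈ Set.Icc (-C) C} := by
    have hset : {A : Matrix (Fin n) (Fin n) ℝ | ∀ i j, A i j ∈ Set.Icc (-C) C} =
        (Set.pi Set.univ fun _ => Set.pi Set.univ fun _ => Set.Icc (-C) C :
          Set (Fin n → Fin n → ℝ)) := by
      ext A
      exact ⟨fun hA i _ j _ => hA i j, fun hA i j => hA i trivial j trivial⟩
    rw [hset]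
    exact isCompact_univ_pi fun _ => isCompact_univ_pi fun _ => isCompact_Icc
  have : FirstCountableTopology (Matrix (Fin n) (Fin n) ℝ) :=
    inferInstanceAs (FirstCountableTopology (Fin n → Fin n → ℝ))
  obtain ⟨⟨A, B⟩, -, φ, hφ, hlim⟩ := (hc.prod hc).tendsto_subseq (x := fun k => (H k, H' k))
    fun k => ⟨fun i j => abs_le.1 (h k i j), fun i j => abs_le.1 (h' k i j)⟩
  exact ⟨A, B, φ, hφ, (continuous_fst.tendsto _).comp hlim, (continuous_snd.tendsto _).comp hlim⟩

lemma isSymm_of_tendsto {H : ℕ → Matrix (Fin n) (Fin n) ℝ} {A : Matrix (Fin n) (Fin n) ℝ}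
    (hH : ∀ k, (H k).IsSymm) (h : Tendsto H atTop (𝓝 A)) : A.IsSymm := by
  have h1 : Tendsto (fun k => (H k).transpose) atTop (𝓝 A.transpose) :=
    (continuous_id.matrix_transpose.tendsto A).comp h
  exact tendsto_nhds_unique h1 (h.congr fun k => (hH k).symm)

end Matrices

section Perturbation

lemma norm_sq_expand {V : Type*} [NormedAddCommGroup V] [InnerProductSpace ℝ V] (x z : V) :
    ‖z‖ ^ 2 = ‖x‖ ^ 2 + 2 * ⟪x, z - x⟫ + ‖z - x‖ ^ 2 := by
  rw [← norm_add_sq_real]; congr 2; abel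

/-- Passing from a second-order expansion of `u + (lam/2)|·|²` to one of `u`. -/
lemma twiceDiffAt_of_taylor {n : ℕ} {u : EuclideanSpace ℝ (Fin n) → ℝ} {lam : ℝ}
    {x q : EuclideanSpace ℝ (Fin n)}
    {T : EuclideanSpace ℝ (Fin n) →L[ℝ] EuclideanSpace ℝ (Fin n)}
    (h : (fun z => (u z + lam / 2 * ‖z‖ ^ 2) - (u x + lam / 2 * ‖x‖ ^ 2) - ⟪q, z - x⟫ -
      (1 / 2) * ⟪T (z - x), z - x⟫) =o[𝓝 x] fun z => ‖z - x‖ ^ 2) :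
    TwiceDiffAt u x (q - lam • x)
      (symmMatrix (T - lam • ContinuousLinearMap.id ℝ (EuclideanSpace ℝ (Fin n)))) := by
  set S := T - lam • ContinuousLinearMap.id ℝ (EuclideanSpace ℝ (Fin n)) with hS
  have hTaylor : (fun z => u z - u x - ⟪q - lam • x, z - x⟫ -
      (1 / 2) * quad (symmMatrix S) (z - x)) =o[𝓝 x] fun z => ‖z - x‖ ^ 2 := by
    refine h.congr_left fun z => ?_
    have e : ⟪S (z - x), z - x⟫ = ⟪T (z - x), z - x⟫ - lam * ‖z - x‖ ^ 2 := by
      rw [hS, sub_apply, smul_apply, ContinuousLinearMap.id_apply, inner_sub_left,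
        real_inner_smul_left, real_inner_self_eq_norm_sq]
    rw [quad_symmMatrix, e, inner_sub_left, real_inner_smul_left, norm_sq_expand x z]
    ring
  refine ⟨hasGradientAt_of_abs_le_sq (C := 1 + ‖S‖) ?_, hTaylor⟩
  filter_upwards [hTaylor.bound one_pos] with z hz
  rw [Real.norm_eq_abs, one_mul, Real.norm_of_nonneg (by positivity), quad_symmMatrix] at hz
  have h1 := inner_apply_self_le S (z - x)
  have h2 := inner_apply_self_le (-S) (z - x)
  rw [neg_apply, inner_neg_left, norm_neg] at h2
  have hz' := abs_le.1 hz
  have hn : 0 ≤ ‖S‖ * ‖z - x‖ ^ 2 := by positivity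
  rw [abs_le]
  constructor <;> linarith [hz'.1, hz'.2]

/-- The gradient of a Taylor expansion of a convex function is a subgradient. -/
lemma isSubgrad_of_taylor {V : Type*} [NormedAddCommGroup V] [InnerProductSpace ℝ V] {U : Set V}
    {f : V → ℝ} (hf : ConvexOn ℝ U f) {x q : V} (hx : x ∈ U) {T : V →L[ℝ] V}
    (h : (fun z => f z - f x - ⟪q, z - x⟫ - (1 / 2) * ⟪T (z - x), z - x⟫) =o[𝓝 x]
      fun z => ‖z - x‖ ^ 2) : IsSubgrad U f x q := by
  refine isSubgrad_of_eventually_lower hf hx (C := 1 + ‖T‖ / 2) ?_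
  filter_upwards [h.bound one_pos] with z hz
  rw [Real.norm_eq_abs, one_mul, Real.norm_of_nonneg (by positivity)] at hz
  have h2 := inner_apply_self_le (-T) (z - x)
  rw [neg_apply, inner_neg_left, norm_neg] at h2
  linarith [(abs_le.1 hz).1]

/-- A gradient of `u` at a point where `u + (lam/2)|·|²` has a subgradient and a second-order upper
bound with the same slope. -/
lemma hasGradientAt_of_subgrad_of_upper {V : Type*} [NormedAddCommGroup V]
    [InnerProductSpace ℝ V] [CompleteSpace V] {U : Set V} {u : V → ℝ} {lam ρ C : ℝ} {x q : V}
    (hlam : 0 ≤ lam) (hρ : 0 < ρ) (hC : 0 ≤ C) (hU : Metric.ball x ρ ⊆ U)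
    (hsub : IsSubgrad U (fun z => u z + lam / 2 * ‖z‖ ^ 2) x q)
    (hup : ∀ z ∈ Metric.ball x ρ, u z + lam / 2 * ‖z‖ ^ 2 ≤
      u x + lam / 2 * ‖x‖ ^ 2 + ⟪q, z - x⟫ + C * ‖z - x‖ ^ 2) :
    HasGradientAt u (q - lam • x) x := by
  refine hasGradientAt_of_abs_le_sq (C := C + lam / 2) ?_
  filter_upwards [Metric.ball_mem_nhds x hρ] with z hz
  have h1 := hsub z (hU hz)
  have h2 := hup z hz
  simp only at h1
  have hn : 0 ≤ C * ‖z - x‖ ^ 2 := by positivity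
  have hn' : 0 ≤ lam / 2 * ‖z - x‖ ^ 2 := by positivity
  rw [norm_sq_expand x z] at h1 h2
  rw [inner_sub_left, real_inner_smul_left, abs_le]
  constructor <;> linarith

end Perturbation

/-- (Strong Addition) If `u, v` are `lam`-quasi-convex on a ball around `x₀` and `w = u + v`
has an upper contact jet `(p₀, A₀)` at `x₀`, then for every set `E` of full measure near
`x₀` there is a sequence `x_j ∈ E`, `x_j → x₀`, at which both `u` and `v` are twice
differentiable, with `Du(x_j) → Du(x₀)`, `Dv(x_j) → Dv(x₀)`, `Du(x₀) + Dv(x₀) = p₀`,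
`D²u(x_j) → A`, `D²v(x_j) → B` and `A + B ≤ A₀`. -/
theorem stmt_17 {n : ℕ} (x₀ : EuclideanSpace ℝ (Fin n)) (r : ℝ) (hr : 0 < r)
    (u v : EuclideanSpace ℝ (Fin n) → ℝ) (lam : ℝ) (hlam : 0 ≤ lam)
    (hqcu : QCOn lam (Metric.ball x₀ r) u) (hqcv : QCOn lam (Metric.ball x₀ r) v)
    (p₀ : EuclideanSpace ℝ (Fin n)) (A₀ : Matrix (Fin n) (Fin n) ℝ) (hA₀ : A₀.IsSymm)
    (hjet : UpperContactJet (fun y => u y + v y) x₀ p₀ A₀)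
    (E : Set (EuclideanSpace ℝ (Fin n)))
    (hE : ∃ V ∈ 𝓝 x₀, volume (V \ E) = 0) :
    ∃ (x : ℕ → EuclideanSpace ℝ (Fin n))
      (gu gv : ℕ → EuclideanSpace ℝ (Fin n))
      (Hu Hv : ℕ → Matrix (Fin n) (Fin n) ℝ)
      (gu₀ gv₀ : EuclideanSpace ℝ (Fin n)) (A B : Matrix (Fin n) (Fin n) ℝ),
        (∀ j, x j ∈ E) ∧ Tendsto x atTop (𝓝 x₀) ∧
        (∀ j, (Hu j).IsSymm ∧ (Hv j).IsSymm ∧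
          TwiceDiffAt u (x j) (gu j) (Hu j) ∧ TwiceDiffAt v (x j) (gv j) (Hv j)) ∧
        HasGradientAt u gu₀ x₀ ∧ HasGradientAt v gv₀ x₀ ∧ gu₀ + gv₀ = p₀ ∧
        Tendsto gu atTop (𝓝 gu₀) ∧ Tendsto gv atTop (𝓝 gv₀) ∧
        A.IsSymm ∧ B.IsSymm ∧ Tendsto Hu atTop (𝓝 A) ∧ Tendsto Hv atTop (𝓝 B) ∧
        (A₀ - A - B).PosSemidef := by
  set f : EuclideanSpace ℝ (Fin n) → ℝ := fun x => u x + lam / 2 * ‖x‖ ^ 2 with hf_def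
  set g : EuclideanSpace ℝ (Fin n) → ℝ := fun x => v x + lam / 2 * ‖x‖ ^ 2 with hg_def
  have hf : ConvexOn ℝ (Metric.ball x₀ r) f := hqcu
  have hg : ConvexOn ℝ (Metric.ball x₀ r) g := hqcv
  have hUo : IsOpen (Metric.ball x₀ r) := Metric.isOpen_ball
  have hx₀ : x₀ ∈ Metric.ball x₀ r := Metric.mem_ball_self hr
  obtain ⟨T₀, hT₀, hquad⟩ := exists_selfAdjoint_inner_eq_quad hA₀
  obtain ⟨V, hV, hVE⟩ := hE
  set b := p₀ + (2 * lam) • x₀ with hb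
  obtain ⟨R, hR, hball⟩ := Metric.eventually_nhds_iff_ball.1
    ((hjet.and (Metric.ball_mem_nhds x₀ hr)).and hV)
  have hupper : ∀ y ∈ Metric.ball x₀ R, f y + g y ≤ f x₀ + g x₀ + ⟪b, y - x₀⟫ +
      (1 / 2) * ⟪T₀ (y - x₀), y - x₀⟫ + lam * ‖y - x₀‖ ^ 2 := by
    intro y hy
    have h := (hball y hy).1.1
    rw [← hquad] at h
    simp only [hf_def, hg_def, hb]
    rw [inner_add_left, real_inner_smul_left, norm_sq_expand x₀ y]
    linarith
  have hRr : Metric.ball x₀ R ⊆ Metric.ball x₀ r := fun y hy => (hball y hy).1.2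
  set C := ‖T₀‖ / 2 + lam with hC_def
  have hC : 0 ≤ C := by positivity
  have hupperC : ∀ y ∈ Metric.ball x₀ R,
      f y + g y ≤ f x₀ + g x₀ + ⟪b, y - x₀⟫ + C * ‖y - x₀‖ ^ 2 := by
    intro y hy
    have h1 := hupper y hy
    have h2 := inner_apply_self_le T₀ (y - x₀)
    rw [hC_def]
    linarith
  obtain ⟨qg₀, hqg₀⟩ := exists_isSubgrad hUo hg hx₀
  have hfup : ∀ y ∈ Metric.ball x₀ R,
      f y ≤ f x₀ + ⟪b - qg₀, y - x₀⟫ + C * ‖y - x₀‖ ^ 2 := by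
    intro y hy
    have h1 := hqg₀ y (hRr hy)
    have h2 := hupperC y hy
    rw [inner_sub_left]
    linarith
  have hqf₀ : IsSubgrad (Metric.ball x₀ r) f x₀ (b - qg₀) :=
    isSubgrad_of_eventually_upper hUo hf hx₀
      (Filter.mem_of_superset (Metric.ball_mem_nhds x₀ hR) hfup)
  have hgup : ∀ y ∈ Metric.ball x₀ R, g y ≤ g x₀ + ⟪qg₀, y - x₀⟫ + C * ‖y - x₀‖ ^ 2 := by
    intro y hy
    have h1 := hqf₀ y (hRr hy)
    have h2 := hupperC y hy
    rw [inner_sub_left] at h1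
    linarith
  have hexists : ∀ k : ℕ, ∃ x qf qg, ∃ Tf Tg : EuclideanSpace ℝ (Fin n) →L[ℝ]
      EuclideanSpace ℝ (Fin n), x ∈ Metric.ball x₀ (R / (k + 3)) ∧ x ∈ E ∧
      ((fun z => f z - f x - ⟪qf, z - x⟫ - (1 / 2) * ⟪Tf (z - x), z - x⟫) =o[𝓝 x]
        fun z => ‖z - x‖ ^ 2) ∧
      ((fun z => g z - g x - ⟪qg, z - x⟫ - (1 / 2) * ⟪Tg (z - x), z - x⟫) =o[𝓝 x]
        fun z => ‖z - x‖ ^ 2) ∧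
      (∀ e, 0 ≤ ⟪Tf e, e⟫) ∧ (∀ e, 0 ≤ ⟪Tg e, e⟫) ∧
      ∀ e, ⟪Tf e, e⟫ + ⟪Tg e, e⟫ ≤
        quad A₀ e + (2 * lam + 2 * (1 / ((k : ℝ) + 1))) * ‖e‖ ^ 2 := by
    intro k
    set c : ℝ := 2 * lam + 2 * (1 / ((k : ℝ) + 1)) with hc
    set T := T₀ + c • ContinuousLinearMap.id ℝ (EuclideanSpace ℝ (Fin n)) with hT_def
    have hTquad : ∀ e, ⟪T e, e⟫ = ⟪T₀ e, e⟫ + c * ‖e‖ ^ 2 := by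
      intro e
      rw [hT_def, add_apply, smul_apply, ContinuousLinearMap.id_apply,
        inner_add_left, real_inner_smul_left, real_inner_self_eq_norm_sq]
    have hTsymm : ∀ x y, ⟪T x, y⟫ = ⟪x, T y⟫ := by
      intro x y
      simp only [hT_def, add_apply, smul_apply, ContinuousLinearMap.id_apply,
        inner_add_left, inner_add_right, real_inner_smul_left, inner_smul_right, hT₀ x y]
    have hk : (0 : ℝ) < k + 3 := by positivity
    have hlt : R / (k + 3) < R := div_lt_self hR (by linarith [k.cast_nonneg (α := ℝ)])
    have hsub : Metric.closedBall x₀ (R / (k + 3)) ⊆ Metric.ball x₀ R :=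
      Metric.closedBall_subset_ball hlt
    have hae : ∀ᵐ x, x ∈ Metric.ball x₀ (R / (k + 3)) → x ∈ E := by
      filter_upwards [measure_eq_zero_iff_ae_notMem.1 hVE] with x hx hxb
      by_contra hxE
      exact hx ⟨(hball x (hsub (Metric.ball_subset_closedBall hxb))).2, hxE⟩
    obtain ⟨x, qf, qg, Tf, Tg, h1, h2, h3, h4, h5, h6, h7⟩ :=
      exists_taylor_two_add_le hUo hf hg (T := T) (b := b) (ε := 1 / ((k : ℝ) + 1))
        hTsymm (div_pos hR hk) (by positivity) (hsub.trans hRr) (fun z hz => by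
          have h := hupper z (hsub hz)
          rw [hTquad, hc]
          linarith) hae
    refine ⟨x, qf, qg, Tf, Tg, h1, h2, h3, h4, h5, h6, fun e => ?_⟩
    rw [← hquad, ← hTquad]
    exact h7 e
  choose x qf qg Tf Tg hxball hxE hTf hTg hTf0 hTg0 hle using hexists
  have hdist : ∀ k, ‖x k - x₀‖ < R / (k + 3) := fun k => mem_ball_iff_norm.1 (hxball k)
  have hdistR : ∀ k, 2 * ‖x k - x₀‖ < R := by
    intro k
    have h1 := hdist k
    rw [lt_div_iff₀ (by positivity)] at h1
    nlinarith [norm_nonneg (x k - x₀), k.cast_nonneg (α := ℝ)]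
  have hxr : ∀ k, x k ∈ Metric.ball x₀ r := fun k =>
    hRr (mem_ball_iff_norm.2 (by linarith [hdistR k, norm_nonneg (x k - x₀)]))
  have hxlim : Tendsto x atTop (𝓝 x₀) := by
    rw [tendsto_iff_norm_sub_tendsto_zero]
    have h : Tendsto (fun k : ℕ => R / ((k : ℝ) + 3)) atTop (𝓝 0) :=
      tendsto_const_nhds.div_atTop
        (tendsto_atTop_add_const_right _ _ tendsto_natCast_atTop_atTop)
    exact squeeze_zero (fun _ => norm_nonneg _) (fun k => (hdist k).le) h
  have hgradlim : ∀ (q : ℕ → EuclideanSpace ℝ (Fin n)) (q₀ : EuclideanSpace ℝ (Fin n)),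
      (∀ k, ‖q k - q₀‖ ≤ 4 * C * ‖x k - x₀‖) →
      Tendsto (fun k => q k - lam • x k) atTop (𝓝 (q₀ - lam • x₀)) := by
    intro q q₀ hq
    refine Tendsto.sub ?_ (hxlim.const_smul lam)
    rw [tendsto_iff_norm_sub_tendsto_zero]
    refine squeeze_zero (fun _ => norm_nonneg _) hq ?_
    simpa using (tendsto_iff_norm_sub_tendsto_zero.1 hxlim).const_mul (4 * C)
  have hqf := hgradlim qf (b - qg₀) fun k => norm_sub_le_of_isSubgrad hRr hfup hC
    (hqf₀ _ (hxr k)) (isSubgrad_of_taylor hf (hxr k) (hTf k)) (hdistR k)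
  have hqg := hgradlim qg qg₀ fun k => norm_sub_le_of_isSubgrad hRr hgup hC
    (hqg₀ _ (hxr k)) (isSubgrad_of_taylor hg (hxr k) (hTg k)) (hdistR k)
  set Hu : ℕ → Matrix (Fin n) (Fin n) ℝ := fun k =>
    symmMatrix (Tf k - lam • ContinuousLinearMap.id ℝ (EuclideanSpace ℝ (Fin n))) with hHu
  set Hv : ℕ → Matrix (Fin n) (Fin n) ℝ := fun k =>
    symmMatrix (Tg k - lam • ContinuousLinearMap.id ℝ (EuclideanSpace ℝ (Fin n))) with hHv
  have hquadHu : ∀ k e, quad (Hu k) e = ⟪Tf k e, e⟫ - lam * ‖e‖ ^ 2 := fun k e => by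
    rw [hHu, quad_symmMatrix, sub_apply, smul_apply, ContinuousLinearMap.id_apply,
      inner_sub_left, real_inner_smul_left, real_inner_self_eq_norm_sq]
  have hquadHv : ∀ k e, quad (Hv k) e = ⟪Tg k e, e⟫ - lam * ‖e‖ ^ 2 := fun k e => by
    rw [hHv, quad_symmMatrix, sub_apply, smul_apply, ContinuousLinearMap.id_apply,
      inner_sub_left, real_inner_smul_left, real_inner_self_eq_norm_sq]
  have hbound : ∀ k e, ⟪Tf k e, e⟫ + ⟪Tg k e, e⟫ ≤ (‖T₀‖ + 2 * lam + 2) * ‖e‖ ^ 2 := by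
    intro k e
    have h1 := hle k e
    rw [← hquad] at h1
    have h2 := inner_apply_self_le T₀ e
    have h3 : 1 / ((k : ℝ) + 1) ≤ 1 := by
      rw [div_le_one (by positivity)]
      linarith [k.cast_nonneg (α := ℝ)]
    have h4 := mul_le_mul_of_nonneg_right h3 (sq_nonneg ‖e‖)
    linarith
  have hK : 0 ≤ ‖T₀‖ + 2 * lam + 2 := by positivity
  have hHuB : ∀ k i j, |Hu k i j| ≤ 2 * (‖T₀‖ + 2 * lam + 2) := fun k =>
    abs_apply_le_of_abs_quad_le (isSymm_symmMatrix _) hK fun e => by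
      have h1 : 0 ≤ ‖T₀‖ * ‖e‖ ^ 2 := by positivity
      have h2 : 0 ≤ lam * ‖e‖ ^ 2 := by positivity
      have h3 := sq_nonneg ‖e‖
      rw [hquadHu, abs_le]
      constructor <;> linarith [hbound k e, hTf0 k e, hTg0 k e]
  have hHvB : ∀ k i j, |Hv k i j| ≤ 2 * (‖T₀‖ + 2 * lam + 2) := fun k =>
    abs_apply_le_of_abs_quad_le (isSymm_symmMatrix _) hK fun e => by
      have h1 : 0 ≤ ‖T₀‖ * ‖e‖ ^ 2 := by positivity
      have h2 : 0 ≤ lam * ‖e‖ ^ 2 := by positivity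
      have h3 := sq_nonneg ‖e‖
      rw [hquadHv, abs_le]
      constructor <;> linarith [hbound k e, hTf0 k e, hTg0 k e]
  obtain ⟨A, B, φ, hφ, hA, hB⟩ := exists_subseq_tendsto_of_abs_apply_le hHuB hHvB
  have hAsymm : A.IsSymm := isSymm_of_tendsto (fun k => isSymm_symmMatrix _) hA
  have hBsymm : B.IsSymm := isSymm_of_tendsto (fun k => isSymm_symmMatrix _) hB
  have hφt := hφ.tendsto_atTop
  have hlim : ∀ e, quad A e + quad B e ≤ quad A₀ e := by
    intro e
    have h1 := (((continuous_quad e).tendsto A).comp hA).add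
      (((continuous_quad e).tendsto B).comp hB)
    have h2 : Tendsto (fun k : ℕ => quad A₀ e + 2 * (1 / ((φ k : ℝ) + 1)) * ‖e‖ ^ 2) atTop
        (𝓝 (quad A₀ e)) := by
      simpa using (((tendsto_one_div_add_atTop_nhds_zero_nat (𝕜 := ℝ)).comp hφt).const_mul
        2 |>.mul_const (‖e‖ ^ 2)).const_add (quad A₀ e)
    refine le_of_tendsto_of_tendsto' h1 h2 fun k => ?_
    simp only [Function.comp_apply]
    rw [hquadHu, hquadHv]
    linarith [hle (φ k) e]
  refine ⟨x ∘ φ, fun k => qf (φ k) - lam • x (φ k), fun k => qg (φ k) - lam • x (φ k),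
    Hu ∘ φ, Hv ∘ φ, b - qg₀ - lam • x₀, qg₀ - lam • x₀, A, B, fun k => hxE _,
    hxlim.comp hφt, fun k => ⟨isSymm_symmMatrix _, isSymm_symmMatrix _,
      twiceDiffAt_of_taylor (hTf _), twiceDiffAt_of_taylor (hTg _)⟩,
    hasGradientAt_of_subgrad_of_upper hlam hR hC hRr hqf₀ hfup,
    hasGradientAt_of_subgrad_of_upper hlam hR hC hRr hqg₀ hgup, ?_,
    hqf.comp hφt, hqg.comp hφt, hAsymm, hBsymm, hA, hB, ?_⟩
  · rw [hb]
    module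
  · refine Matrix.PosSemidef.of_dotProduct_mulVec_nonneg ?_ fun e => ?_
    · rw [Matrix.IsHermitian, Matrix.conjTranspose_eq_transpose_of_trivial]
      exact (hA₀.sub hAsymm).sub hBsymm
    · have h := hlim (WithLp.toLp 2 e)
      simp only [quad_eq_dotProduct] at h
      rw [star_trivial, Matrix.sub_mulVec, Matrix.sub_mulVec, dotProduct_sub, dotProduct_sub]
      linarith
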